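/- arXiv:2502.00228 — 5 statements merged into one kernel-verified Lean document; each statement's English description precedes it below -/
import Mathlib

section
/- For every i ∈ {1,…,n} and every state s ∈ V, the optimal value function x ↦ Φ(x, s, i) is monotone nondecreasing and 1-Lipschitz on [0, ∞); that is, for all 0 ≤ a ≤ b one has 0 ≤ Φ(b, s, i) − Φ(a, s, i) ≤ b − a. -/
open Finset

/-- A single-line Markovian Pandora's box instance with `n` boxes, opened in the fixed
order `0, 1, …, n-1`, and rewards taking values among `v 0 < v 1 < … < v (k-1)`. -/
structure LineInstance (n k : ℕ) : Type where
  n_pos : 0 < n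
  k_pos : 0 < k
  /-- the possible reward values -/
  v : Fin k → ℝ
  v_mono : StrictMono v
  v_nonneg : ∀ j, 0 ≤ v j
  /-- opening costs -/
  c : Fin n → ℝ
  c_nonneg : ∀ i, 0 ≤ c i
  /-- distribution of the reward of the first box -/
  p0 : Fin k → ℝ
  p0_nonneg : ∀ j, 0 ≤ p0 j
  p0_sum : ∑ j, p0 j = 1
  /-- `P i s y`: probability that box `i` has reward value `v y` given that box `i-1`
  had reward value `v s` (used for `1 ≤ i`). -/
  P : ℕ → Fin k → Fin k → ℝ
  P_nonneg : ∀ i s y, 0 ≤ P i s y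
  P_sum : ∀ i s, ∑ y, P i s y = 1

namespace LineInstance

variable {n k : ℕ}

/-- Law of the reward of box `i` given that box `i-1` had reward value `v s`
(for `i = 0`, the unconditioned initial law: the conditioning is vacuous). -/
def step (L : LineInstance n k) (i : ℕ) (s : Fin k) : Fin k → ℝ :=
  if i = 0 then L.p0 else L.P i s

/-- A stopping rule: given the list of reward values observed since the start, decide
whether to stop now (before opening the next box).  Thus the event of stopping after
exactly `m` boxes is determined by the first `m` observed rewards. -/
abbrev Rule (k : ℕ) : Type := List (Fin k) → Bool

/-- Value of the stopping rule `τ` when the next box to open is `i`, the best reward in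
hand (outside option) is `x`, the last observed state is `s`, and `hist` is the list of
rewards observed so far.  When `i = n` (no box remains) the value is `x`. -/
noncomputable def ruleVal (L : LineInstance n k) (τ : Rule k)
    (i : ℕ) (x : ℝ) (s : Fin k) (hist : List (Fin k)) : ℝ :=
  if h : i < n then
    if τ hist then x
    else
      -L.c ⟨i, h⟩ +
        ∑ y : Fin k, L.step i s y * L.ruleVal τ (i + 1) (max x (L.v y)) y (hist ++ [y])
  else x
termination_by n - i
decreasing_by omega

/-- `Φ(x, s, i)`: the optimal value over all stopping rules, when the next box to open is
`i`, the outside option is `x` and the last observed state is `s`. -/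
noncomputable def phi (L : LineInstance n k) (x : ℝ) (s : Fin k) (i : ℕ) : ℝ :=
  ⨆ τ : Rule k, L.ruleVal τ i x s []

/-- the largest possible reward value `v_k` -/
def vmax (L : LineInstance n k) : ℝ := L.v ⟨k - 1, Nat.sub_lt L.k_pos Nat.one_pos⟩

/-- The generalized reservation value `σ_i(s)`: the least `x ∈ [0, v_k]` with
`Φ(x, s, i) = x`. -/
noncomputable def grv (L : LineInstance n k) (s : Fin k) (i : ℕ) : ℝ :=
  sInf {x : ℝ | x ∈ Set.Icc 0 L.vmax ∧ L.phi x s i = x}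

end LineInstance

namespace LineInstance

variable {n k : ℕ}

theorem step_nonneg (L : LineInstance n k) (i : ℕ) (s y : Fin k) : 0 ≤ L.step i s y := by
  unfold step
  split_ifs
  exacts [L.p0_nonneg y, L.P_nonneg i s y]

theorem sum_step (L : LineInstance n k) (i : ℕ) (s : Fin k) : ∑ y, L.step i s y = 1 := by
  unfold step
  split_ifs
  exacts [L.p0_sum, L.P_sum i s]

theorem v_le_vmax (L : LineInstance n k) (y : Fin k) : L.v y ≤ L.vmax :=
  L.v_mono.monotone (Fin.le_def.2 (Nat.le_sub_one_of_lt y.isLt))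

theorem ruleVal_mono (L : LineInstance n k) (τ : Rule k) (i : ℕ) (s : Fin k)
    (hist : List (Fin k)) {a b : ℝ} (hab : a ≤ b) :
    L.ruleVal τ i a s hist ≤ L.ruleVal τ i b s hist := by
  rw [ruleVal, ruleVal]
  split_ifs with h hτ
  · exact hab
  · gcongr with y
    · exact L.step_nonneg i s y
    · exact L.ruleVal_mono τ (i + 1) y _ (max_le_max_right _ hab)
  · exact hab
termination_by n - i
decreasing_by omega

theorem ruleVal_le_add_sub (L : LineInstance n k) (τ : Rule k) (i : ℕ) (s : Fin k)
    (hist : List (Fin k)) {a b : ℝ} (hab : a ≤ b) :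
    L.ruleVal τ i b s hist ≤ L.ruleVal τ i a s hist + (b - a) := by
  rw [ruleVal, ruleVal]
  split_ifs with h hτ
  · linarith
  · have key : ∑ y, L.step i s y * L.ruleVal τ (i + 1) (max b (L.v y)) y (hist ++ [y]) ≤
        ∑ y, L.step i s y *
          (L.ruleVal τ (i + 1) (max a (L.v y)) y (hist ++ [y]) + (b - a)) := by
      gcongr with y
      · exact L.step_nonneg i s y
      · refine (L.ruleVal_le_add_sub τ (i + 1) y _ (max_le_max_right (L.v y) hab)).trans ?_
        have : max b (L.v y) ≤ max a (L.v y) + (b - a) :=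
          max_le (by linarith [le_max_left a (L.v y)]) (by linarith [le_max_right a (L.v y)])
        linarith
    simp only [mul_add, sum_add_distrib, ← sum_mul, L.sum_step, one_mul] at key
    linarith
  · linarith
termination_by n - i
decreasing_by omega

theorem ruleVal_le_max (L : LineInstance n k) (τ : Rule k) (i : ℕ) (x : ℝ) (s : Fin k)
    (hist : List (Fin k)) : L.ruleVal τ i x s hist ≤ max x L.vmax := by
  rw [ruleVal]
  split_ifs with h hτ
  · exact le_max_left _ _
  · have key : ∑ y, L.step i s y * L.ruleVal τ (i + 1) (max x (L.v y)) y (hist ++ [y]) ≤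
        ∑ y, L.step i s y * max x L.vmax := by
      gcongr with y
      · exact L.step_nonneg i s y
      · refine (L.ruleVal_le_max τ (i + 1) _ y _).trans ?_
        rw [max_assoc, max_eq_right (L.v_le_vmax y)]
    rw [← sum_mul, L.sum_step, one_mul] at key
    linarith [L.c_nonneg ⟨i, h⟩]
  · exact le_max_left _ _
termination_by n - i
decreasing_by omega

theorem bddAbove_range_ruleVal (L : LineInstance n k) (i : ℕ) (x : ℝ) (s : Fin k) :
    BddAbove (Set.range fun τ : Rule k => L.ruleVal τ i x s []) :=
  ⟨max x L.vmax, Set.forall_mem_range.2 fun τ => L.ruleVal_le_max τ i x s []⟩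

end LineInstance

open LineInstance in
/-- For every box index `i` and state `s`, the optimal value `x ↦ Φ(x, s, i)` is monotone
nondecreasing and 1-Lipschitz on `[0, ∞)`: for all `0 ≤ a ≤ b`,
`0 ≤ Φ(b, s, i) − Φ(a, s, i) ≤ b − a`. -/
theorem phi_monotone_and_one_lipschitz {n k : ℕ} (L : LineInstance n k)
    (i : ℕ) (hi : i < n) (s : Fin k) (a b : ℝ) (ha : 0 ≤ a) (hab : a ≤ b) :
    0 ≤ L.phi b s i - L.phi a s i ∧ L.phi b s i - L.phi a s i ≤ b - a := by
  constructor
  · exact sub_nonneg.2 (ciSup_mono (L.bddAbove_range_ruleVal i b s)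
      fun τ => L.ruleVal_mono τ i s [] hab)
  · rw [sub_le_iff_le_add']
    exact ciSup_le fun τ => (L.ruleVal_le_add_sub τ i s [] hab).trans
      (add_le_add_left (le_ciSup (L.bddAbove_range_ruleVal i a s) τ) _)
end

section
/- The threshold rule defined by the generalized reservation values is an optimal stopping rule: for every i ∈ {1,…,n}, state s ∈ V, and outside option x ≥ 0, let τ_σ be the stopping rule that stops at the first index m ∈ {i−1, i, …, n} such that either m = n or the current maximum max{x, R_i, …, R_m} ≥ σ_{m+1}(R_m) (for m = i−1 the condition reads x ≥ σ_i(s)). Then Φ^{τ_σ}(x, s, i) = Φ(x, s, i). -/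
open Finset

namespace LineInstance

variable {n k : ℕ}

/-- The threshold rule defined by the generalized reservation values, started with the
next box being `i`, outside option `x` and last state `s`: after observing history `h`
(so the next box is `i + |h|`, the last observed state is the last entry of `h`, or `s`
if `h` is empty, and the current maximum is `max{x, rewards in h}`), stop iff the current
maximum is at least the generalized reservation value of the next box.  (Reaching the end
of the line forces stopping in `ruleVal` itself.) -/
noncomputable def thresholdRule (L : LineInstance n k) (x : ℝ) (s : Fin k) (i : ℕ) :
    Rule k :=
  fun h =>
    if L.grv (h.getLastD s) (i + h.length) ≤ h.foldr (fun y m => max (L.v y) m) x then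
      true
    else false

end LineInstance

namespace LineInstance

variable {n k : ℕ}

theorem vmax_nonneg (L : LineInstance n k) : 0 ≤ L.vmax := L.v_nonneg _

/-- Transition averages preserve pointwise bounds. -/
theorem sum_step_mul_le (L : LineInstance n k) (i : ℕ) (s : Fin k) {f g : Fin k → ℝ} {a : ℝ}
    (h : ∀ y, f y ≤ g y + a) :
    ∑ y, L.step i s y * f y ≤ ∑ y, L.step i s y * g y + a := by
  calc ∑ y, L.step i s y * f y
      ≤ ∑ y, L.step i s y * (g y + a) :=
        Finset.sum_le_sum fun y _ => mul_le_mul_of_nonneg_left (h y) (L.step_nonneg i s y)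
    _ = ∑ y, L.step i s y * g y + a := by
        simp only [mul_add, Finset.sum_add_distrib, ← Finset.sum_mul, L.sum_step, one_mul]

/-- The value function defined by the dynamic programming recursion. -/
noncomputable def bellman (L : LineInstance n k) (i : ℕ) (x : ℝ) (s : Fin k) : ℝ :=
  if h : i < n then
    max x (-L.c ⟨i, h⟩ + ∑ y : Fin k, L.step i s y * L.bellman (i + 1) (max x (L.v y)) y)
  else x
termination_by n - i
decreasing_by omega

theorem bellman_of_lt (L : LineInstance n k) {i : ℕ} (h : i < n) (x : ℝ) (s : Fin k) :
    L.bellman i x s =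
      max x (-L.c ⟨i, h⟩ +
        ∑ y : Fin k, L.step i s y * L.bellman (i + 1) (max x (L.v y)) y) := by
  rw [bellman, dif_pos h]

theorem bellman_of_not_lt (L : LineInstance n k) {i : ℕ} (h : ¬ i < n) (x : ℝ) (s : Fin k) :
    L.bellman i x s = x := by
  rw [bellman, dif_neg h]

theorem le_bellman (L : LineInstance n k) (i : ℕ) (x : ℝ) (s : Fin k) :
    x ≤ L.bellman i x s := by
  by_cases h : i < n
  · rw [L.bellman_of_lt h]
    exact le_max_left _ _
  · rw [L.bellman_of_not_lt h]

theorem bellman_mono (L : LineInstance n k) (i : ℕ) {x y : ℝ} (hxy : x ≤ y) (s : Fin k) :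
    L.bellman i x s ≤ L.bellman i y s := by
  by_cases h : i < n
  · rw [L.bellman_of_lt h, L.bellman_of_lt h]
    refine max_le_max hxy (add_le_add_right ?_ _)
    exact Finset.sum_le_sum fun z _ => mul_le_mul_of_nonneg_left
      (L.bellman_mono (i + 1) (max_le_max_right _ hxy) z) (L.step_nonneg i s z)
  · rwa [L.bellman_of_not_lt h, L.bellman_of_not_lt h]
termination_by n - i
decreasing_by omega

theorem bellman_le_add_sub (L : LineInstance n k) (i : ℕ) {x y : ℝ} (hxy : x ≤ y)
    (s : Fin k) : L.bellman i y s ≤ L.bellman i x s + (y - x) := by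
  by_cases h : i < n
  · rw [L.bellman_of_lt h, L.bellman_of_lt h]
    have key := L.sum_step_mul_le i s (a := y - x)
      (f := fun z => L.bellman (i + 1) (max y (L.v z)) z)
      (g := fun z => L.bellman (i + 1) (max x (L.v z)) z) fun z => by
        have h1 := L.bellman_le_add_sub (i + 1) (max_le_max_right (L.v z) hxy) z
        have h2 : max y (L.v z) ≤ max x (L.v z) + (y - x) :=
          max_le (by linarith [le_max_left x (L.v z)]) (by linarith [le_max_right x (L.v z)])
        linarith
    refine max_le ?_ ?_
    · linarith [le_max_left x (-L.c ⟨i, h⟩ +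
        ∑ z : Fin k, L.step i s z * L.bellman (i + 1) (max x (L.v z)) z)]
    · linarith [le_max_right x (-L.c ⟨i, h⟩ +
        ∑ z : Fin k, L.step i s z * L.bellman (i + 1) (max x (L.v z)) z)]
  · rw [L.bellman_of_not_lt h, L.bellman_of_not_lt h]
    linarith
termination_by n - i
decreasing_by omega

theorem continuous_bellman (L : LineInstance n k) (i : ℕ) (s : Fin k) :
    Continuous fun x => L.bellman i x s := by
  refine (LipschitzWith.of_le_add fun x y => ?_).continuous
  rcases le_total x y with h | h
  · linarith [L.bellman_mono i h s, dist_nonneg (x := x) (y := y)]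
  · linarith [L.bellman_le_add_sub i h s, le_abs_self (x - y), Real.dist_eq x y]

theorem bellman_vmax (L : LineInstance n k) (i : ℕ) (s : Fin k) :
    L.bellman i L.vmax s = L.vmax := by
  by_cases h : i < n
  · rw [L.bellman_of_lt h]
    have hstep (y : Fin k) : L.bellman (i + 1) (max L.vmax (L.v y)) y = L.vmax := by
      rw [max_eq_left (L.v_le_vmax y)]
      exact L.bellman_vmax (i + 1) y
    simp only [hstep, ← Finset.sum_mul, L.sum_step, one_mul]
    exact max_eq_left (by linarith [L.c_nonneg ⟨i, h⟩])
  · rw [L.bellman_of_not_lt h]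
termination_by n - i
decreasing_by omega

theorem ruleVal_le_bellman (L : LineInstance n k) (τ : Rule k) (i : ℕ) (x : ℝ) (s : Fin k)
    (hist : List (Fin k)) : L.ruleVal τ i x s hist ≤ L.bellman i x s := by
  by_cases h : i < n
  · rw [ruleVal, dif_pos h]
    split_ifs
    · exact L.le_bellman i x s
    · rw [L.bellman_of_lt h]
      refine le_max_of_le_right (add_le_add_right ?_ _)
      exact Finset.sum_le_sum fun y _ => mul_le_mul_of_nonneg_left
        (L.ruleVal_le_bellman τ (i + 1) _ y _) (L.step_nonneg i s y)
  · rw [ruleVal, dif_neg h, L.bellman_of_not_lt h]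
termination_by n - i
decreasing_by omega

/-- The best reward in hand after observing `h`, starting from outside option `x`. -/
noncomputable def best (L : LineInstance n k) (x : ℝ) (h : List (Fin k)) : ℝ :=
  h.foldr (fun y m => max (L.v y) m) x

theorem best_concat (L : LineInstance n k) (x : ℝ) (h : List (Fin k)) (y : Fin k) :
    L.best x (h ++ [y]) = max (L.best x h) (L.v y) := by
  induction h with
  | nil => exact max_comm _ _
  | cons z h ih =>
    change max (L.v z) (L.best x (h ++ [y])) = max (max (L.v z) (L.best x h)) (L.v y)
    rw [ih, max_assoc]

theorem le_best (L : LineInstance n k) (x : ℝ) (h : List (Fin k)) : x ≤ L.best x h := by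
  induction h with
  | nil => exact le_rfl
  | cons z h ih => exact le_max_of_le_right ih

/-- A rule which stops only where stopping is optimal, and whenever continuing is not,
attains the dynamic programming value. -/
theorem ruleVal_eq_bellman (L : LineInstance n k) (τ : Rule k) (i : ℕ) (x : ℝ) (s : Fin k)
    (hτ : ∀ h, τ h = true ↔
      L.bellman (i + h.length) (L.best x h) (h.getLastD s) = L.best x h)
    (h : List (Fin k)) :
    L.ruleVal τ (i + h.length) (L.best x h) (h.getLastD s) h =
      L.bellman (i + h.length) (L.best x h) (h.getLastD s) := by
  by_cases hn : i + h.length < n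
  · rw [ruleVal, dif_pos hn]
    split_ifs with hs
    · exact ((hτ h).mp hs).symm
    · rw [hτ, L.bellman_of_lt hn] at hs
      rw [L.bellman_of_lt hn, max_eq_right (le_of_not_ge fun hle => hs (max_eq_left hle))]
      congr 1
      refine Finset.sum_congr rfl fun y _ => ?_
      have ih := L.ruleVal_eq_bellman τ i x s hτ (h ++ [y])
      rw [L.best_concat, List.getLastD_concat, List.length_append, List.length_singleton,
        ← add_assoc] at ih
      rw [ih]
  · rw [ruleVal, dif_neg hn, L.bellman_of_not_lt hn]
termination_by n - (i + h.length)
decreasing_by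
  rw [List.length_append, List.length_singleton]
  omega

theorem phi_eq_bellman (L : LineInstance n k) (x : ℝ) (s : Fin k) (i : ℕ) :
    L.phi x s i = L.bellman i x s := by
  classical
  refine le_antisymm (ciSup_le fun τ => L.ruleVal_le_bellman τ i x s []) ?_
  let τ : Rule k := fun h =>
    decide (L.bellman (i + h.length) (L.best x h) (h.getLastD s) = L.best x h)
  have hτ : L.ruleVal τ i x s [] = L.bellman i x s :=
    L.ruleVal_eq_bellman τ i x s (fun h => decide_eq_true_iff) []
  rw [← hτ]
  exact le_ciSup (f := fun τ : Rule k => L.ruleVal τ i x s [])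
    ⟨L.bellman i x s, Set.forall_mem_range.mpr fun τ => L.ruleVal_le_bellman τ i x s []⟩ τ

theorem isLeast_grv (L : LineInstance n k) (s : Fin k) (i : ℕ) :
    IsLeast {x : ℝ | x ∈ Set.Icc 0 L.vmax ∧ L.phi x s i = x} (L.grv s i) := by
  have hbdd : BddBelow {x : ℝ | x ∈ Set.Icc 0 L.vmax ∧ L.phi x s i = x} :=
    ⟨0, fun x hx => hx.1.1⟩
  refine ⟨IsClosed.csInf_mem ?_ ⟨L.vmax, ⟨L.vmax_nonneg, le_rfl⟩, ?_⟩ hbdd,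
    fun x hx => csInf_le hbdd hx⟩
  · simp only [phi_eq_bellman]
    exact isClosed_Icc.inter (isClosed_eq (L.continuous_bellman i s) continuous_id)
  · rw [phi_eq_bellman, bellman_vmax]

/-- Stopping is optimal exactly when the best reward in hand reaches the generalized
reservation value. -/
theorem grv_le_iff (L : LineInstance n k) (s : Fin k) (i : ℕ) {x : ℝ} (hx : 0 ≤ x) :
    L.grv s i ≤ x ↔ L.bellman i x s = x := by
  have hleast := L.isLeast_grv s i
  refine ⟨fun h => le_antisymm ?_ (L.le_bellman i x s), fun h => ?_⟩
  · have hfix := hleast.1.2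
    rw [phi_eq_bellman] at hfix
    linarith [L.bellman_le_add_sub i h s]
  · rcases le_total x L.vmax with hv | hv
    · exact hleast.2 ⟨⟨hx, hv⟩, by rw [phi_eq_bellman, h]⟩
    · exact hleast.1.1.2.trans hv

end LineInstance

open LineInstance in
/-- The threshold rule given by the generalized reservation values is an optimal stopping
rule: `Φ^{τ_σ}(x, s, i) = Φ(x, s, i)`. -/
theorem thresholdRule_optimal {n k : ℕ} (L : LineInstance n k)
    (i : ℕ) (hi : i < n) (s : Fin k) (x : ℝ) (hx : 0 ≤ x) :
    L.ruleVal (L.thresholdRule x s i) i x s [] = L.phi x s i := by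
  rw [phi_eq_bellman]
  refine L.ruleVal_eq_bellman (L.thresholdRule x s i) i x s (fun h => ?_) []
  rw [← L.grv_le_iff _ _ (hx.trans (L.le_best x h))]
  simp [thresholdRule, best]
end

section
/- Let 1 ≤ t ≤ n and δ ∈ (0, 1), and suppose that Pr[max_{1 ≤ j ≤ t} R_j = v_k] ≥ 1 − δ. Then optimal probing restricted to the first t boxes is near-optimal: OPT(L|t) ≥ OPT(L) − 2 δ v_k. -/
open Finset

namespace LineInstance

variable {n k : ℕ}

/-- The truncated instance `L|t`, consisting of the first `t` boxes of `L` with the same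
Markov law. -/
def truncate (L : LineInstance n k) (t : ℕ) (ht0 : 0 < t) (ht : t ≤ n) :
    LineInstance t k where
  n_pos := ht0
  k_pos := L.k_pos
  v := L.v
  v_mono := L.v_mono
  v_nonneg := L.v_nonneg
  c := fun j => L.c ⟨j, lt_of_lt_of_le j.isLt ht⟩
  c_nonneg := fun j => L.c_nonneg _
  p0 := L.p0
  p0_nonneg := L.p0_nonneg
  p0_sum := L.p0_sum
  P := L.P
  P_nonneg := L.P_nonneg
  P_sum := L.P_sum

/-- Probability (under the Markov law) of observing the reward-value path `ω` for the
first `t` boxes. -/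
noncomputable def pathProb (L : LineInstance n k) {t : ℕ} (ω : Fin t → Fin k) : ℝ :=
  ∏ j : Fin t,
    L.step j (ω ⟨(j : ℕ) - 1, lt_of_le_of_lt (Nat.sub_le _ _) j.isLt⟩) (ω j)

open Classical in
/-- `Pr[max_{1 ≤ j ≤ t} R_j = v_k]`: the probability that some box among the first `t`
attains the top reward value `v_k`. -/
noncomputable def probTopWithin (L : LineInstance n k) (t : ℕ) : ℝ :=
  ∑ ω : Fin t → Fin k, if ∃ j : Fin t, L.v (ω j) = L.vmax then L.pathProb ω else 0

/-- `OPT(L)`: the optimal expected utility for probing the whole line, starting from the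
first box with outside option `0` (the state argument is irrelevant for the first box). -/
noncomputable def OPT (L : LineInstance n k) : ℝ := L.phi 0 ⟨0, L.k_pos⟩ 0

end LineInstance

namespace LineInstance

variable {n k : ℕ}

/-- Probability of observing the rewards `ω` in the boxes `i, …, i + m - 1` when the state
before box `i` is `s`. -/
noncomputable def pathProbFrom (L : LineInstance n k) {m : ℕ} (i : ℕ) (s : Fin k)
    (ω : Fin m → Fin k) : ℝ :=
  ∏ j : Fin m, L.step (i + j) ((Fin.cons s ω : Fin (m + 1) → Fin k) j.castSucc) (ω j)

theorem pathProb_eq_pathProbFrom (L : LineInstance n k) {t : ℕ} (s : Fin k)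
    (ω : Fin t → Fin k) : L.pathProb ω = L.pathProbFrom 0 s ω := by
  unfold pathProb pathProbFrom
  refine Finset.prod_congr rfl fun j _ => ?_
  obtain ⟨j, hj⟩ := j
  cases j with
  | zero => simp [step]
  | succ j =>
    have : (Fin.castSucc ⟨j + 1, hj⟩ : Fin (t + 1)) = Fin.succ ⟨j, by omega⟩ := rfl
    rw [this, Fin.cons_succ]
    simp

theorem pathProbFrom_cons (L : LineInstance n k) {m : ℕ} (i : ℕ) (s y : Fin k)
    (ω : Fin m → Fin k) :
    L.pathProbFrom i s (Fin.cons y ω : Fin (m + 1) → Fin k) =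
      L.step i s y * L.pathProbFrom (i + 1) y ω := by
  unfold pathProbFrom
  rw [Fin.prod_univ_succ]
  congr 1
  refine Finset.prod_congr rfl fun j _ => ?_
  rw [Fin.castSucc_succ, Fin.cons_succ, Fin.cons_succ, Fin.val_succ,
    show i + (↑j + 1) = i + 1 + ↑j by omega]

theorem sum_fin_cons {m : ℕ} (f : (Fin (m + 1) → Fin k) → ℝ) :
    ∑ ω, f ω = ∑ y, ∑ ω : Fin m → Fin k, f (Fin.cons y ω) := by
  rw [← (Fin.consEquiv fun _ : Fin (m + 1) => Fin k).sum_comp, Fintype.sum_prod_type]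
  rfl

theorem sum_pathProbFrom (L : LineInstance n k) (m i : ℕ) (s : Fin k) :
    ∑ ω : Fin m → Fin k, L.pathProbFrom i s ω = 1 := by
  induction m generalizing i s with
  | zero => simp [pathProbFrom]
  | succ m ih =>
    simp only [sum_fin_cons, pathProbFrom_cons, ← Finset.mul_sum, ih, mul_one, sum_step]

open Classical in
/-- Probability that one of the boxes `i, …, i + m - 1` attains the top reward value when the
state before box `i` is `s`. -/
noncomputable def hitProb (L : LineInstance n k) : ℕ → ℕ → Fin k → ℝ
  | 0, _, _ => 0
  | m + 1, i, s =>
    ∑ y, L.step i s y * if L.v y = L.vmax then 1 else L.hitProb m (i + 1) y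

theorem hitProb_le_one (L : LineInstance n k) (m i : ℕ) (s : Fin k) :
    L.hitProb m i s ≤ 1 := by
  induction m generalizing i s with
  | zero => simp [hitProb]
  | succ m ih =>
    rw [hitProb]
    refine (Finset.sum_le_sum fun y _ => ?_).trans_eq (L.sum_step i s)
    refine mul_le_of_le_one_right (L.step_nonneg i s y) ?_
    split_ifs
    exacts [le_rfl, ih _ _]

open Classical in
theorem sum_pathProbFrom_top (L : LineInstance n k) (m i : ℕ) (s : Fin k) :
    (∑ ω : Fin m → Fin k,
      if ∃ j, L.v (ω j) = L.vmax then L.pathProbFrom i s ω else 0) = L.hitProb m i s := by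
  induction m generalizing i s with
  | zero => simp [hitProb]
  | succ m ih =>
    rw [sum_fin_cons, hitProb]
    refine Finset.sum_congr rfl fun y _ => ?_
    simp only [Fin.exists_fin_succ, Fin.cons_zero, Fin.cons_succ, pathProbFrom_cons]
    split_ifs with hy
    · simp only [hy, true_or, if_true, ← Finset.mul_sum, sum_pathProbFrom]
    · simp only [hy, false_or, ← ih, Finset.mul_sum, mul_ite, mul_zero]

theorem probTopWithin_eq_hitProb (L : LineInstance n k) (t : ℕ) (s : Fin k) :
    L.probTopWithin t = L.hitProb t 0 s := by
  simp only [probTopWithin, L.pathProb_eq_pathProbFrom s, sum_pathProbFrom_top]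

theorem ruleVal_of_lt (L : LineInstance n k) (τ : Rule k) {i : ℕ} (hi : i < n) (x : ℝ)
    (s : Fin k) (hist : List (Fin k)) :
    L.ruleVal τ i x s hist = if τ hist then x else -L.c ⟨i, hi⟩ +
      ∑ y : Fin k, L.step i s y * L.ruleVal τ (i + 1) (max x (L.v y)) y (hist ++ [y]) := by
  rw [ruleVal, dif_pos hi]

theorem ruleVal_of_le (L : LineInstance n k) (τ : Rule k) {i : ℕ} (hi : n ≤ i) (x : ℝ)
    (s : Fin k) (hist : List (Fin k)) : L.ruleVal τ i x s hist = x := by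
  rw [ruleVal, dif_neg hi.not_gt]

theorem ruleVal_le_vmax (L : LineInstance n k) (τ : Rule k) (i : ℕ) (x : ℝ) (s : Fin k)
    (hist : List (Fin k)) (hx : x ≤ L.vmax) : L.ruleVal τ i x s hist ≤ L.vmax := by
  induction h : n - i generalizing i x s hist with
  | zero =>
    rw [L.ruleVal_of_le τ (by omega)]
    exact hx
  | succ d ih =>
    rw [L.ruleVal_of_lt τ (by omega)]
    split_ifs
    · exact hx
    · have hsum : ∑ y, L.step i s y * L.ruleVal τ (i + 1) (max x (L.v y)) y (hist ++ [y]) ≤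
          ∑ y, L.step i s y * L.vmax := by
        refine Finset.sum_le_sum fun y _ => mul_le_mul_of_nonneg_left ?_ (L.step_nonneg i s y)
        exact ih _ _ _ _ (max_le hx (L.v_le_vmax y)) (by omega)
      rw [← Finset.sum_mul, sum_step, one_mul] at hsum
      linarith [L.c_nonneg ⟨i, by omega⟩]

open Classical in
/-- Following the same rule in the truncated instance loses at most `vmax` on the event that
the top reward value has not been seen before the truncation. -/
theorem ruleVal_le_truncate (L : LineInstance n k) {t : ℕ} (ht0 : 0 < t) (ht : t ≤ n)
    (τ : Rule k) (m i : ℕ) (him : i + m = t) (x : ℝ) (s : Fin k) (hist : List (Fin k))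
    (hx0 : 0 ≤ x) (hx : x ≤ L.vmax) :
    L.ruleVal τ i x s hist ≤ (L.truncate t ht0 ht).ruleVal τ i x s hist +
      L.vmax * if x = L.vmax then 0 else 1 - L.hitProb m i s := by
  induction m generalizing i x s hist with
  | zero =>
    have hval := L.ruleVal_le_vmax τ i x s hist hx
    rw [(L.truncate t ht0 ht).ruleVal_of_le τ (by omega)]
    split_ifs with h
    · linarith
    · simp only [hitProb]
      linarith
  | succ m ih =>
    rw [L.ruleVal_of_lt τ (by omega), (L.truncate t ht0 ht).ruleVal_of_lt τ (by omega)]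
    split_ifs with hτ hxv hxv
    · simp
    · nlinarith [L.vmax_nonneg, L.hitProb_le_one (m + 1) i s]
    all_goals
      have hsum : ∑ y, L.step i s y * L.ruleVal τ (i + 1) (max x (L.v y)) y (hist ++ [y]) ≤
          ∑ y, L.step i s y *
            ((L.truncate t ht0 ht).ruleVal τ (i + 1) (max x (L.v y)) y (hist ++ [y]) +
              L.vmax * if max x (L.v y) = L.vmax then 0 else 1 - L.hitProb m (i + 1) y) := by
        refine Finset.sum_le_sum fun y _ => mul_le_mul_of_nonneg_left ?_ (L.step_nonneg i s y)
        exact ih _ (by omega) _ _ _ (le_max_of_le_left hx0) (max_le hx (L.v_le_vmax y))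
      have hstep : (L.truncate t ht0 ht).step i s = L.step i s := rfl
      have hv : (L.truncate t ht0 ht).v = L.v := rfl
      have hc : (L.truncate t ht0 ht).c ⟨i, by omega⟩ = L.c ⟨i, by omega⟩ := rfl
      simp only [mul_add, Finset.sum_add_distrib] at hsum
      rw [hstep, hv, hc]
    · have hmax (y : Fin k) : max x (L.v y) = L.vmax :=
        (max_eq_left (hxv ▸ L.v_le_vmax y)).trans hxv
      simp only [hmax, if_true, mul_zero, Finset.sum_const_zero] at hsum ⊢
      linarith
    · have hmiss : 1 - L.hitProb (m + 1) i s = ∑ y, L.step i s y *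
          if max x (L.v y) = L.vmax then 0 else 1 - L.hitProb m (i + 1) y := by
        refine (congrArg (· - L.hitProb (m + 1) i s) (L.sum_step i s).symm).trans ?_
        rw [hitProb, ← Finset.sum_sub_distrib]
        refine Finset.sum_congr rfl fun y _ => ?_
        have hiff : max x (L.v y) = L.vmax ↔ L.v y = L.vmax := by
          constructor
          · intro h
            rcases max_choice x (L.v y) with h' | h'
            · exact absurd (h'.symm.trans h) hxv
            · exact h'.symm.trans h
          · intro h
            rw [h, max_eq_right hx]
        simp only [hiff]
        split_ifs <;> ring
      rw [hmiss, Finset.mul_sum]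
      simp only [mul_left_comm (L.vmax)]
      linarith

end LineInstance

open LineInstance in
/-- If `1 ≤ t ≤ n`, `δ ∈ (0,1)` and `Pr[max_{1 ≤ j ≤ t} R_j = v_k] ≥ 1 − δ`, then optimal
probing restricted to the first `t` boxes is near-optimal:
`OPT(L|t) ≥ OPT(L) − 2 δ v_k`. -/
theorem truncated_near_optimal {n k : ℕ} (L : LineInstance n k)
    (t : ℕ) (ht0 : 0 < t) (ht : t ≤ n) (δ : ℝ) (hδ0 : 0 < δ) (hδ1 : δ < 1)
    (hprob : 1 - δ ≤ L.probTopWithin t) :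
    (L.truncate t ht0 ht).OPT ≥ L.OPT - 2 * δ * L.vmax := by
  have hv := L.vmax_nonneg
  have hbdd : BddAbove (Set.range fun τ : Rule k =>
      (L.truncate t ht0 ht).ruleVal τ 0 0 ⟨0, L.k_pos⟩ []) :=
    ⟨L.vmax, by
      rintro _ ⟨τ, rfl⟩
      exact (L.truncate t ht0 ht).ruleVal_le_vmax τ 0 0 _ [] hv⟩
  rw [ge_iff_le, sub_le_iff_le_add]
  refine ciSup_le fun τ => ?_
  have hτ := L.ruleVal_le_truncate ht0 ht τ t 0 (by omega) 0 ⟨0, L.k_pos⟩ [] le_rfl hv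
  have hopt : (L.truncate t ht0 ht).ruleVal τ 0 0 ⟨0, L.k_pos⟩ [] ≤
      (L.truncate t ht0 ht).OPT := le_ciSup hbdd τ
  rw [L.probTopWithin_eq_hitProb t ⟨0, L.k_pos⟩] at hprob
  split_ifs at hτ
  · nlinarith
  · nlinarith
end

section
/- The Bellman operator for the infinite homogeneous chain with constant cost is a contraction: f satisfies d(f(Φ), f(Ψ)) ≤ q · d(Φ, Ψ) for all Φ, Ψ ∈ X, where q = max_{j ∈ {1,…,k}} (1 − p_{j,k}) < 1. Consequently f has a unique fixed point Φ* in X, and for any starting point Φ^0 the iterates Φ^t := f(Φ^{t−1}) satisfy d(Φ^t, Φ*) ≤ q^t · d(Φ^0, Φ*), so they converge to Φ*. -/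
open Finset Filter

/-- Banach's fixed point theorem, with the geometric rate measured from the fixed point. -/
theorem exists_unique_fixedPoint_of_dist_le_mul {X : Type*} [MetricSpace X] [CompleteSpace X]
    [Nonempty X] {f : X → X} {q : ℝ} (hq0 : 0 ≤ q) (hq1 : q < 1)
    (hf : ∀ x y, dist (f x) (f y) ≤ q * dist x y) :
    ∃ z, f z = z ∧ (∀ y, f y = y → y = z) ∧
      ∀ x, (∀ t : ℕ, dist (f^[t] x) z ≤ q ^ t * dist x z) ∧
        Tendsto (fun t : ℕ => f^[t] x) atTop (nhds z) := by
  lift q to NNReal using hq0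
  have hcon : ContractingWith q f :=
    ⟨by exact_mod_cast hq1, LipschitzWith.of_dist_le_mul hf⟩
  have hz : f (ContractingWith.fixedPoint f hcon) = ContractingWith.fixedPoint f hcon :=
    hcon.fixedPoint_isFixedPt
  refine ⟨ContractingWith.fixedPoint f hcon, hz, fun y hy => hcon.fixedPoint_unique hy,
    fun x => ⟨fun t => ?_, hcon.tendsto_iterate_fixedPoint x⟩⟩
  have h := (hcon.toLipschitzWith.iterate t).dist_le_mul x (ContractingWith.fixedPoint f hcon)
  rw [Function.iterate_fixed hz] at h
  exact_mod_cast h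

/-- The Bellman operator for the infinite homogeneous chain with constant cost `c` is a
contraction on `X = ℝ^{(k−1)×k}` (with the sup metric, which is the metric of the pi type
`Fin (k-1) × Fin k → ℝ`) with contraction factor `q = max_j (1 − p_{j,k}) < 1`; hence it
has a unique fixed point `Φ*`, and for any starting point `Φ⁰` the iterates
`Φᵗ = f(Φᵗ⁻¹)` satisfy `d(Φᵗ, Φ*) ≤ qᵗ · d(Φ⁰, Φ*)` and converge to `Φ*`. -/
theorem bellman_operator_contraction
    (k : ℕ) (hk : 2 ≤ k)
    (v : Fin k → ℝ) (hv : StrictMono v)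
    (c : ℝ) (hc : 0 ≤ c)
    (P : Fin k → Fin k → ℝ)
    (hP0 : ∀ i j, 0 ≤ P i j) (hP1 : ∀ i, ∑ j, P i j = 1)
    (hPk : ∀ j : Fin k, 0 < P j ⟨k - 1, by omega⟩)
    (f : ((Fin (k - 1) × Fin k) → ℝ) → ((Fin (k - 1) × Fin k) → ℝ))
    (hf : ∀ (Φ : (Fin (k - 1) × Fin k) → ℝ) (i : Fin (k - 1)) (j : Fin k),
      f Φ (i, j) =
        max (v ⟨(i : ℕ), by omega⟩)
          (-c + ∑ l : Fin k,
            if (l : ℕ) ≤ (i : ℕ) then P j l * Φ (i, l)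
            else if hl : (l : ℕ) < k - 1 then P j l * Φ (⟨(l : ℕ), hl⟩, l)
            else P j l * v ⟨k - 1, by omega⟩))
    (q : ℝ) (hq : q = ⨆ j : Fin k, (1 - P j ⟨k - 1, by omega⟩)) :
    q < 1 ∧
    (∀ Φ Ψ : (Fin (k - 1) × Fin k) → ℝ, dist (f Φ) (f Ψ) ≤ q * dist Φ Ψ) ∧
    ∃ Φs : (Fin (k - 1) × Fin k) → ℝ,
      f Φs = Φs ∧ (∀ Ψ, f Ψ = Ψ → Ψ = Φs) ∧
      ∀ Φ0 : (Fin (k - 1) × Fin k) → ℝ,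
        (∀ t : ℕ, dist (f^[t] Φ0) Φs ≤ q ^ t * dist Φ0 Φs) ∧
        Tendsto (fun t : ℕ => f^[t] Φ0) atTop (nhds Φs) := by
  have : Nonempty (Fin k) := ⟨⟨0, by omega⟩⟩
  have hle : ∀ j, 1 - P j ⟨k - 1, by omega⟩ ≤ q := fun j => by
    rw [hq]
    exact le_ciSup (f := fun j : Fin k => 1 - P j ⟨k - 1, by omega⟩) (Set.finite_range _).bddAbove j
  have hq1 : q < 1 := by
    obtain ⟨j, hj⟩ := exists_eq_ciSup_of_finite (f := fun j : Fin k => 1 - P j ⟨k - 1, by omega⟩)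
    rw [hq, ← hj]
    linarith [hPk j]
  have hq0 : 0 ≤ q := by
    let j : Fin k := ⟨0, by omega⟩
    have h := Finset.single_le_sum (fun l _ => hP0 j l) (Finset.mem_univ (⟨k - 1, by omega⟩ : Fin k))
    rw [hP1 j] at h
    linarith [hle j]
  have hcon : ∀ Φ Ψ : (Fin (k - 1) × Fin k) → ℝ, dist (f Φ) (f Ψ) ≤ q * dist Φ Ψ := by
    intro Φ Ψ
    refine (dist_pi_le_iff (by positivity)).2 fun ⟨i, j⟩ => ?_
    have hcoord : ∀ x, |Φ x - Ψ x| ≤ dist Φ Ψ := fun x => by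
      simpa only [Real.dist_eq] using dist_le_pi_dist Φ Ψ x
    have hmul : ∀ l x, |P j l * Φ x - P j l * Ψ x| ≤ P j l * dist Φ Ψ := fun l x => by
      rw [← mul_sub, abs_mul, abs_of_nonneg (hP0 j l)]
      exact mul_le_mul_of_nonneg_left (hcoord x) (hP0 j l)
    have hsum : ∑ l : Fin k, (P j l - if l = ⟨k - 1, by omega⟩ then P j l else 0) * dist Φ Ψ
        = (1 - P j ⟨k - 1, by omega⟩) * dist Φ Ψ := by
      rw [← Finset.sum_mul, Finset.sum_sub_distrib, hP1 j, Finset.sum_ite_eq']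
      simp
    rw [Real.dist_eq, hf, hf]
    refine (abs_max_sub_max_le_max _ _ _ _).trans (max_le ?_ ?_)
    · rw [sub_self, abs_zero]
      positivity
    rw [add_sub_add_left_eq_sub, ← Finset.sum_sub_distrib]
    refine (Finset.abs_sum_le_sum_abs _ _).trans ?_
    refine le_trans (Finset.sum_le_sum fun l _ => ?_)
      (hsum.le.trans (mul_le_mul_of_nonneg_right (hle j) dist_nonneg))
    by_cases hl : (l : ℕ) < k - 1
    · have hne : l ≠ ⟨k - 1, by omega⟩ := fun h => by simp [h] at hl
      rw [if_neg hne, sub_zero]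
      split_ifs <;> exact hmul _ _
    · have heq : l = ⟨k - 1, by omega⟩ := Fin.ext (by simp only; omega)
      have hi : ¬ (l : ℕ) ≤ (i : ℕ) := by omega
      simp only [if_neg hi, dif_neg hl, if_pos heq, sub_self, abs_zero, zero_mul, le_refl]
  exact ⟨hq1, hcon, exists_unique_fixedPoint_of_dist_le_mul hq0 hq1 hcon⟩
end

section
/- Suppose φ : {1,…,k} × {1,…,k} → ℝ satisfies φ(k, j) = v_k for all j, together with the Bellman equations φ(l, i) = max{ v_l, −c + Σ_{j=1}^{k} p_{i,j} · φ(max{l, j}, j) } for all l ∈ {1,…,k−1} and all i ∈ {1,…,k}. If p_{i,k} · (v_k − v_{k−1}) > c for every i ∈ {1,…,k}, then φ(k−1, i) > v_{k−1} for every i ∈ {1,…,k}; that is, whenever the current maximum reward is at most v_{k−1}, continuing to probe is strictly better than stopping, so the optimal strategy continues until the top value v_k is realized. -/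
open Finset

/-- Homogeneous Markov chain of boxes with values `v 0 < … < v (k-1)` and constant cost
`c`.  Suppose `φ l i` (the optimal expected future payoff when the current maximum is
`v l` and the current state is `v i`) satisfies `φ (k-1) i = v (k-1)` together with the
Bellman equations `φ l i = max { v l, −c + Σ_j p_{i,j} · φ (max l j) j }` for all
non-top `l`.  If `p_{i,(k-1)} · (v (k-1) − v (k-2)) > c` for every `i`, then
`φ (k-2) i > v (k-2)` for every `i`: whenever the current maximum is at most `v (k-2)`,
continuing to probe is strictly better than stopping, so the optimal strategy continues
until the top value is realized. -/
theorem continue_until_top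
    (k : ℕ) (hk : 2 ≤ k)
    (v : Fin k → ℝ) (hv : StrictMono v)
    (c : ℝ) (hc : 0 ≤ c)
    (P : Fin k → Fin k → ℝ)
    (hP0 : ∀ i j, 0 ≤ P i j) (hP1 : ∀ i, ∑ j, P i j = 1)
    (φ : Fin k → Fin k → ℝ)
    (htop : ∀ i : Fin k, φ ⟨k - 1, by omega⟩ i = v ⟨k - 1, by omega⟩)
    (hbell : ∀ l i : Fin k, (l : ℕ) < k - 1 →
      φ l i = max (v l) (-c + ∑ j : Fin k, P i j * φ (max l j) j))
    (hgap : ∀ i : Fin k, c < P i ⟨k - 1, by omega⟩ * (v ⟨k - 1, by omega⟩ - v ⟨k - 2, by omega⟩)) :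
    ∀ i : Fin k, v ⟨k - 2, by omega⟩ < φ ⟨k - 2, by omega⟩ i := by
  intro i
  set t : Fin k := ⟨k - 1, by omega⟩ with ht
  set l : Fin k := ⟨k - 2, by omega⟩ with hl
  have hlt : (l : ℕ) < k - 1 := by simp only [hl]; omega
  have hφ : ∀ m j : Fin k, v m ≤ φ m j := by
    intro m j
    by_cases hm : (m : ℕ) < k - 1
    · rw [hbell m j hm]
      exact le_max_left _ _
    · have hmt : m = t := Fin.ext (by have := m.isLt; simp only [ht]; omega)
      rw [hmt, htop]
  have hmax : max l t = t := max_eq_right (Fin.le_def.2 hlt.le)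
  have hterm : P i t * (v t - v l) ≤ ∑ j, P i j * (φ (max l j) j - v l) := by
    have h := single_le_sum (f := fun j => P i j * (φ (max l j) j - v l))
      (fun j _ => mul_nonneg (hP0 i j)
        (sub_nonneg.2 ((hv.monotone (le_max_left l j)).trans (hφ _ j)))) (mem_univ t)
    simpa only [hmax, htop] using h
  have hsum : ∑ j, P i j * (φ (max l j) j - v l) = ∑ j, P i j * φ (max l j) j - v l := by
    simp only [mul_sub, sum_sub_distrib, ← sum_mul, hP1, one_mul]
  rw [hbell l i hlt]
  exact lt_max_of_lt_right (by linarith [hgap i])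
end
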